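/- There exists a universal constant C > 0 such that for every α ∈ ℝ with α ≠ 0 and every x > 0 there exist integrable functions g, g̃ ∈ L¹(ℝ, ℂ) whose Fourier transforms satisfy, for all k ≠ 0, 𝓕g(k) = i k · e^{−|k|x} / (i k + α·sgn(k)) and 𝓕g̃(k) = |k| · e^{−|k|x} / (i k + α·sgn(k)), and such that ∫_ℝ |g(y)| dy ≤ C·(|α|·x)^{−1/4} and ∫_ℝ |g̃(y)| dy ≤ C·(|α|·x)^{−1/4}. -/

import Mathlib

open MeasureTheory Real

/-- The Fourier transform `𝓕g(k) = ∫_ℝ e^{−2πiky} g(y) dy`. -/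
noncomputable def fourierT (g : ℝ → ℂ) (k : ℝ) : ℂ :=
  ∫ y : ℝ, Complex.exp ((-2) * π * k * y * Complex.I) * g y

lemma aux_int (u : ℝ → ℂ) (M : ℝ) (hc : Continuous u) (hM : ∀ t, ‖u t‖ ≤ M) (z : ℂ)
    (hz : 0 < z.re) : IntegrableOn (fun t : ℝ => u t * Complex.exp (-(t * z))) (Set.Ioi 0) := by
  have h := (exp_neg_integrableOn_Ioi 0 hz).const_mul M
  refine Integrable.mono' h (by fun_prop) ?_
  refine Filter.Eventually.of_forall fun t => ?_
  rw [norm_mul, Complex.norm_exp]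
  have : (-(t * z) : ℂ).re = -z.re * t := by simp; ring
  rw [this]
  gcongr
  exact hM t

lemma aux_ibp (u u' : ℝ → ℂ) (M M' : ℝ) (hu : ∀ t, HasDerivAt u (u' t) t) (hc : Continuous u')
    (hM : ∀ t, ‖u t‖ ≤ M) (hM' : ∀ t, ‖u' t‖ ≤ M') (z : ℂ) (hz : 0 < z.re) :
    z * ∫ t in Set.Ioi (0:ℝ), u t * Complex.exp (-(t * z)) =
      u 0 + ∫ t in Set.Ioi (0:ℝ), u' t * Complex.exp (-(t * z)) := by
  have hcu : Continuous u := continuous_iff_continuousAt.2 fun t => (hu t).continuousAt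
  have i1 := aux_int u M hcu hM z hz
  have i2 := aux_int u' M' hc hM' z hz
  have hd : ∀ t : ℝ, HasDerivAt (fun t : ℝ => u t * Complex.exp (-(t * z)))
      (u' t * Complex.exp (-(t * z)) - z * (u t * Complex.exp (-(t * z)))) t := by
    intro t
    have h1 : HasDerivAt (fun t : ℝ => (-(t * z) : ℂ)) (-(1 * z)) t :=
      ((HasDerivAt.ofReal_comp (hasDerivAt_id t)).mul_const z).neg
    refine ((hu t).mul h1.cexp).congr_deriv ?_
    ring
  have ht : Filter.Tendsto (fun t : ℝ => u t * Complex.exp (-(t * z))) Filter.atTop (nhds 0) := by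
    have h2 : Filter.Tendsto (fun t : ℝ => M * rexp (-(z.re * t))) Filter.atTop (nhds 0) := by
      have := (Real.tendsto_exp_neg_atTop_nhds_zero.comp
        (Filter.tendsto_id.const_mul_atTop hz)).const_mul M
      simpa using this
    refine squeeze_zero_norm (fun t => ?_) h2
    rw [norm_mul, Complex.norm_exp]
    have : (-(t * z) : ℂ).re = -(z.re * t) := by simp; ring
    rw [this]
    gcongr
    exact hM t
  have := integral_Ioi_of_hasDerivAt_of_tendsto (a := 0) (hd 0).continuousAt.continuousWithinAt
    (fun t _ => hd t) (i2.sub (i1.const_mul z)) ht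
  rw [integral_sub i2 (i1.const_mul z), integral_const_mul] at this
  simp at this
  linear_combination -this

lemma aux_ne (β : ℝ) (hβ : β ≠ 0) (t : ℝ) : (t - Complex.I * β : ℂ) ≠ 0 := by
  intro h
  have := congrArg Complex.im h
  simp at this
  exact hβ this

lemma aux_norm (β : ℝ) (t : ℝ) : ‖(t - Complex.I * β : ℂ)‖ ^ 2 = t ^ 2 + β ^ 2 := by
  rw [← Complex.normSq_eq_norm_sq, Complex.normSq_apply]; simp; ring

lemma aux_le (β : ℝ) (t : ℝ) : |β| ≤ ‖(t - Complex.I * β : ℂ)‖ := by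
  have := Complex.abs_im_le_norm (t - Complex.I * β : ℂ)
  simpa using this

lemma aux_le' (β : ℝ) (t : ℝ) : |t| ≤ ‖(t - Complex.I * β : ℂ)‖ := by
  have := Complex.abs_re_le_norm (t - Complex.I * β : ℂ)
  simpa using this

lemma aux_d1 (β : ℝ) (hβ : β ≠ 0) (t : ℝ) :
    HasDerivAt (fun t : ℝ => (t / (t - Complex.I * β) : ℂ))
      (-(Complex.I * β) / (t - Complex.I * β) ^ 2) t := by
  have h0 : HasDerivAt (fun t : ℝ => (t : ℂ)) 1 t := HasDerivAt.ofReal_comp (hasDerivAt_id t)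
  refine (h0.div (h0.sub_const (Complex.I * β)) (aux_ne β hβ t)).congr_deriv ?_
  congr 1; ring

lemma aux_d2 (β : ℝ) (hβ : β ≠ 0) (t : ℝ) :
    HasDerivAt (fun t : ℝ => (-(Complex.I * β) / (t - Complex.I * β) ^ 2 : ℂ))
      (2 * (Complex.I * β) / (t - Complex.I * β) ^ 3) t := by
  have h0 : HasDerivAt (fun t : ℝ => (t : ℂ)) 1 t := HasDerivAt.ofReal_comp (hasDerivAt_id t)
  have hn := aux_ne β hβ t
  refine ((hasDerivAt_const t (-(Complex.I * β) : ℂ)).div ((h0.sub_const (Complex.I * β)).pow 2)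
    (pow_ne_zero 2 hn)).congr_deriv ?_
  simp only [Pi.pow_apply]
  field_simp
  simp
  ring

lemma aux_cauchy (β : ℝ) (hβ : β ≠ 0) :
    Integrable (fun t : ℝ => |β| / (t ^ 2 + β ^ 2)) ∧ ∫ t : ℝ, |β| / (t ^ 2 + β ^ 2) = π := by
  have h : (fun t : ℝ => |β| / (t ^ 2 + β ^ 2)) =
      fun t => |β|⁻¹ * (1 + (t / β) ^ 2)⁻¹ := by
    funext t
    have : β ^ 2 = |β| ^ 2 := (sq_abs β).symm
    have hb : |β| ≠ 0 := abs_ne_zero.2 hβ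
    rw [div_pow, this]
    field_simp
    ring
  rw [h]
  refine ⟨(integrable_inv_one_add_sq.comp_div hβ).const_mul _, ?_⟩
  rw [integral_const_mul, Measure.integral_comp_div (fun t => (1 + t ^ 2)⁻¹) β,
    integral_univ_inv_one_add_sq, smul_eq_mul]
  have hb : |β| ≠ 0 := abs_ne_zero.2 hβ
  field_simp

lemma aux_bdexp (u : ℝ → ℂ) (m : ℝ → ℝ) (hm : Integrable m) (h0 : ∀ t, 0 ≤ m t)
    (hu : ∀ t, ‖u t‖ ≤ m t) (z : ℂ) (hz : 0 < z.re) :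
    ‖∫ t in Set.Ioi (0:ℝ), u t * Complex.exp (-(t * z))‖ ≤ ∫ t, m t := by
  refine (norm_integral_le_of_norm_le hm.integrableOn (g := m) ?_).trans
    (setIntegral_le_integral hm (Filter.Eventually.of_forall h0))
  refine (ae_restrict_iff' measurableSet_Ioi).2 (Filter.Eventually.of_forall fun t ht => ?_)
  rw [norm_mul, Complex.norm_exp]
  have h1 : rexp (-(t * z) : ℂ).re ≤ 1 := by
    apply Real.exp_le_one_iff.2
    have : (-(t * z) : ℂ).re = -(t * z.re) := by simp
    rw [this]
    have := mul_pos (Set.mem_Ioi.1 ht) hz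
    linarith
  calc _ ≤ m t * 1 := by gcongr; exacts [h0 t, hu t]
    _ = m t := mul_one _

lemma aux_b0 (β : ℝ) (t : ℝ) : ‖(t / (t - Complex.I * β) : ℂ)‖ ≤ 1 := by
  rw [norm_div]
  apply div_le_one_of_le₀ _ (norm_nonneg _)
  simpa using aux_le' β t

lemma aux_b1 (β : ℝ) (t : ℝ) : ‖(-(Complex.I * β) / (t - Complex.I * β) ^ 2 : ℂ)‖ =
    |β| / (t ^ 2 + β ^ 2) := by
  rw [norm_div, norm_pow, aux_norm]; simp

lemma aux_b2 (β : ℝ) (hβ : β ≠ 0) (t : ℝ) : ‖(2 * (Complex.I * β) / (t - Complex.I * β) ^ 3 : ℂ)‖ ≤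
    2 / |β| * (|β| / (t ^ 2 + β ^ 2)) := by
  have hb : 0 < |β| := abs_pos.2 hβ
  rw [norm_div, norm_pow, pow_succ, aux_norm]
  have h2 : 0 < t ^ 2 + β ^ 2 := by positivity
  have h3 := aux_le β t
  have : ‖(2 * (Complex.I * β) : ℂ)‖ = 2 * |β| := by simp
  rw [this]
  calc 2 * |β| / ((t ^ 2 + β ^ 2) * ‖(t - Complex.I * β : ℂ)‖)
      ≤ 2 * |β| / ((t ^ 2 + β ^ 2) * |β|) := by gcongr
    _ = _ := by field_simp

lemma aux_b3 (β : ℝ) (hβ : β ≠ 0) (t : ℝ) : |β| / (t ^ 2 + β ^ 2) ≤ 1 / |β| := by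
  have hb : 0 < |β| := abs_pos.2 hβ
  rw [div_le_div_iff₀ (by positivity) hb]
  nlinarith [sq_abs β, sq_nonneg t]

lemma aux_H (β : ℝ) (hβ : β ≠ 0) (z : ℂ) (hz : 0 < z.re) :
    ‖∫ t in Set.Ioi (0:ℝ), (t / (t - Complex.I * β) : ℂ) * Complex.exp (-(t * z))‖ ≤
      10 * |β| ^ (-(1:ℝ)/4) * ‖z‖ ^ (-(5:ℝ)/4) := by
  have hb : 0 < |β| := abs_pos.2 hβ
  have hn := aux_ne β hβ
  have hzn : 0 < ‖z‖ := norm_pos_iff.2 (fun h => by simp [h] at hz)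
  have c1 : Continuous (fun t : ℝ => (-(Complex.I * β) / (t - Complex.I * β) ^ 2 : ℂ)) := by
    fun_prop (disch := intro t; exact pow_ne_zero _ (hn t))
  have c2 : Continuous (fun t : ℝ => (2 * (Complex.I * β) / (t - Complex.I * β) ^ 3 : ℂ)) := by
    fun_prop (disch := intro t; exact pow_ne_zero _ (hn t))
  have bd1 : ∀ t : ℝ, ‖(-(Complex.I * β) / (t - Complex.I * β) ^ 2 : ℂ)‖ ≤ 1 / |β| := fun t => by
    rw [aux_b1]; exact aux_b3 β hβ t
  have bd2 : ∀ t : ℝ, ‖(2 * (Complex.I * β) / (t - Complex.I * β) ^ 3 : ℂ)‖ ≤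
      2 / |β| * (1 / |β|) := fun t =>
    (aux_b2 β hβ t).trans (mul_le_mul_of_nonneg_left (aux_b3 β hβ t) (by positivity))
  have e1 := aux_ibp _ _ 1 (1 / |β|) (aux_d1 β hβ) c1 (aux_b0 β) bd1 z hz
  have e2 := aux_ibp _ _ (1 / |β|) _ (aux_d2 β hβ) c2 bd1 bd2 z hz
  obtain ⟨ci, cv⟩ := aux_cauchy β hβ
  have n1 := aux_bdexp _ _ ci (fun t => by positivity) (fun t => (aux_b1 β t).le) z hz
  have n2 := aux_bdexp _ _ (ci.const_mul (2 / |β|)) (fun t => by positivity) (aux_b2 β hβ) z hz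
  rw [integral_const_mul, cv] at n2
  rw [cv] at n1
  set H := ∫ t in Set.Ioi (0:ℝ), (t / (t - Complex.I * β) : ℂ) * Complex.exp (-(t * z))
  set H1 := ∫ t in Set.Ioi (0:ℝ), (-(Complex.I * β) / (t - Complex.I * β) ^ 2 : ℂ) *
    Complex.exp (-(t * z))
  set H2 := ∫ t in Set.Ioi (0:ℝ), (2 * (Complex.I * β) / (t - Complex.I * β) ^ 3 : ℂ) *
    Complex.exp (-(t * z))
  have f1 : ‖z‖ * ‖H‖ ≤ 4 := by
    rw [← norm_mul, e1]; simp; linarith [pi_le_four]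
  have f2 : ‖z‖ * (‖z‖ * ‖H‖) ≤ 9 / |β| := by
    have : z * (z * H) = z * H1 := by rw [e1]; simp
    rw [← norm_mul, ← norm_mul, this, e2]
    refine (norm_add_le _ _).trans ?_
    have := bd1 0
    have h4 : 2 / |β| * π ≤ 2 / |β| * 4 := by gcongr; exact pi_le_four
    calc _ ≤ 1 / |β| + 2 / |β| * 4 := add_le_add this (n2.trans h4)
      _ = 9 / |β| := by ring
  have f3 : (‖z‖ * ‖H‖) ^ 3 * (‖z‖ * (‖z‖ * ‖H‖)) ≤ 4 ^ 3 * (9 / |β|) := by gcongr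
  have f4 : ‖H‖ ^ 4 ≤ (10 * |β| ^ (-(1:ℝ)/4) * ‖z‖ ^ (-(5:ℝ)/4)) ^ 4 := by
    have r1 : (|β| ^ (-(1:ℝ)/4)) ^ 4 = |β|⁻¹ := by
      rw [← Real.rpow_natCast, ← Real.rpow_mul hb.le, ← Real.rpow_neg_one]; norm_num
    have r2 : (‖z‖ ^ (-(5:ℝ)/4)) ^ 4 = (‖z‖ ^ 5)⁻¹ := by
      rw [← Real.rpow_natCast, ← Real.rpow_mul hzn.le, ← Real.rpow_natCast, ← Real.rpow_neg hzn.le]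
      norm_num
    rw [mul_pow, mul_pow, r1, r2, ← div_eq_mul_inv, le_div_iff₀ (by positivity)]
    calc _ = (‖z‖ * ‖H‖) ^ 3 * (‖z‖ * (‖z‖ * ‖H‖)) := by ring
      _ ≤ _ := f3
      _ = 576 * |β|⁻¹ := by ring
      _ ≤ _ := by gcongr; norm_num
  exact le_of_pow_le_pow_left₀ (by norm_num) (by positivity) f4

lemma aux_main (α x : ℝ) (hα : α ≠ 0) (hx : 0 < x) (p : ℝ → ℂ) (c : ℂ) (hc : ‖c‖ = 1)
    (hp : Continuous p) (hp1 : ∀ t, 0 < t → p t = t) (hp2 : ∀ t, 0 < t → p (-t) = c * t) :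
    ∃ g : ℝ → ℂ, Integrable g ∧
      (∀ k : ℝ, fourierT g k = p k / (|k| - Complex.I * α) * Complex.exp (-(|k| * x))) ∧
      (∫ y, ‖g y‖) ≤ (20 * ∫ y : ℝ, (1 + ‖y‖ ^ 2) ^ (-(5/4 : ℝ) / 2)) *
        (|α| * x) ^ (-(1 : ℝ) / 4) := by
  have hn := aux_ne α hα
  set f : ℝ → ℂ := fun k => p k / (((|k| : ℝ) : ℂ) - Complex.I * α) *
    Complex.exp (-(((|k| : ℝ) : ℂ) * x)) with hf
  have fc : Continuous f := by
    have : Continuous fun k : ℝ => (((|k| : ℝ) : ℂ) - Complex.I * α) := by fun_prop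
    exact (hp.div this (fun k => hn |k|)).mul (by fun_prop)
  have f1 : ∀ t : ℝ, 0 < t → f t = t / (t - Complex.I * α) * Complex.exp (-(t * x)) := by
    intro t ht
    simp only [hf, abs_of_pos ht, hp1 t ht]
  have f2 : ∀ t : ℝ, 0 < t →
      f (-t) = c * (t / (t - Complex.I * α) * Complex.exp (-(t * x))) := by
    intro t ht
    simp only [hf, abs_neg, abs_of_pos ht, hp2 t ht]
    ring
  have c0 : Continuous (fun t : ℝ => (t / (t - Complex.I * α) : ℂ)) := by
    fun_prop (disch := exact hn)
  have i0 := aux_int _ 1 c0 (aux_b0 α) (x : ℂ) (by simpa using hx)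
  have i1 : IntegrableOn f (Set.Ioi 0) :=
    i0.congr_fun (fun t ht => (f1 t ht).symm) measurableSet_Ioi
  have i2 : IntegrableOn (fun t => f (-t)) (Set.Ioi 0) :=
    IntegrableOn.congr_fun (i0.const_mul c) (fun t ht => (f2 t ht).symm) measurableSet_Ioi
  have i3 : IntegrableOn f (Set.Iic 0) := by
    have := (integrableOn_Ici_iff_integrableOn_Ioi (by simp)).2 i2
    have h := (Measure.measurePreserving_neg (volume : Measure ℝ)).integrableOn_comp_preimage
      (Homeomorph.neg ℝ).measurableEmbedding (f := f) (s := Set.Iic 0)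
    rw [← h]
    simpa [Function.comp_def] using this
  have fi : Integrable f := by
    rw [← integrableOn_univ, ← Set.Iic_union_Ioi (a := (0:ℝ))]
    exact i3.union i1
  have hb : 0 < |α| := abs_pos.2 hα
  -- pointwise bound of half-line pieces
  have hH : ∀ w : ℝ, ‖∫ t in Set.Ioi (0:ℝ), (t / (t - Complex.I * α) : ℂ) *
      Complex.exp (-(t * (x + 2 * π * w * Complex.I)))‖ ≤
      10 * |α| ^ (-(1:ℝ)/4) * x ^ (-(5:ℝ)/4) * (1 + ‖w / x‖ ^ 2) ^ (-(5/4 : ℝ) / 2) := by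
    intro w
    have h := aux_H α hα (x + 2 * π * w * Complex.I) (by simpa using hx)
    refine h.trans ?_
    rw [mul_assoc (10 * |α| ^ (-(1:ℝ)/4))]
    gcongr
    have hz2 : ‖(x + 2 * π * w * Complex.I : ℂ)‖ ^ 2 = x ^ 2 + (2 * π * w) ^ 2 := by
      rw [← Complex.normSq_eq_norm_sq, Complex.normSq_apply]; simp; ring
    have hz3 : x ^ 2 * (1 + ‖w / x‖ ^ 2) ≤ ‖(x + 2 * π * w * Complex.I : ℂ)‖ ^ 2 := by
      rw [hz2, Real.norm_eq_abs, sq_abs]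
      have : x ^ 2 * (1 + (w / x) ^ 2) = x ^ 2 + w ^ 2 := by field_simp
      rw [this]
      have : 1 ≤ (2 * π) ^ 2 := by nlinarith [pi_gt_three]
      nlinarith [sq_nonneg w]
    have e1 : ‖(x + 2 * π * w * Complex.I : ℂ)‖ ^ (-(5:ℝ)/4) =
        (‖(x + 2 * π * w * Complex.I : ℂ)‖ ^ 2) ^ (-(5/4:ℝ)/2) := by
      rw [← Real.rpow_natCast, ← Real.rpow_mul (norm_nonneg _)]; norm_num
    have e2 : x ^ (-(5:ℝ)/4) = (x ^ 2) ^ (-(5/4:ℝ)/2) := by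
      rw [← Real.rpow_natCast, ← Real.rpow_mul hx.le]; norm_num
    rw [e1, e2, ← Real.mul_rpow (by positivity) (by positivity)]
    exact Real.rpow_le_rpow_of_nonpos (by positivity) hz3 (by norm_num)
  have hF : ∀ w : ℝ, ‖FourierTransform.fourier f w‖ ≤
      20 * |α| ^ (-(1:ℝ)/4) * x ^ (-(5:ℝ)/4) * (1 + ‖w / x‖ ^ 2) ^ (-(5/4 : ℝ) / 2) := by
    intro w
    rw [Real.fourier_real_eq_integral_exp_smul]
    have ii : Integrable (fun v : ℝ => Complex.exp (↑(-2 * π * v * w) * Complex.I) • f v) := by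
      refine Integrable.mono fi (by fun_prop) (Filter.Eventually.of_forall fun v => ?_)
      rw [norm_smul, Complex.norm_exp_ofReal_mul_I, one_mul]
    rw [← intervalIntegral.integral_Iic_add_Ioi (b := 0) ii.integrableOn ii.integrableOn]
    have a1 : ∫ v in Set.Ioi (0:ℝ), Complex.exp (↑(-2 * π * v * w) * Complex.I) • f v =
        ∫ t in Set.Ioi (0:ℝ), (t / (t - Complex.I * α) : ℂ) *
          Complex.exp (-(t * (x + 2 * π * w * Complex.I))) := by
      refine setIntegral_congr_fun measurableSet_Ioi fun t ht => ?_
      rw [f1 t ht, smul_eq_mul, mul_left_comm, ← Complex.exp_add]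
      congr 2; push_cast; ring
    have a2 : ∫ v in Set.Iic (0:ℝ), Complex.exp (↑(-2 * π * v * w) * Complex.I) • f v =
        c * ∫ t in Set.Ioi (0:ℝ), (t / (t - Complex.I * α) : ℂ) *
          Complex.exp (-(t * (x + 2 * π * (-w : ℝ) * Complex.I))) := by
      have := integral_comp_neg_Ioi 0 (fun v : ℝ =>
        Complex.exp (↑(-2 * π * v * w) * Complex.I) • f v)
      rw [neg_zero] at this
      rw [← this, ← integral_const_mul]
      refine setIntegral_congr_fun measurableSet_Ioi fun t ht => ?_
      rw [f2 t ht, smul_eq_mul, mul_left_comm, mul_left_comm (Complex.exp _), ← Complex.exp_add]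
      congr 3; push_cast; ring
    rw [a1, a2]
    refine (norm_add_le _ _).trans ?_
    rw [norm_mul, hc, one_mul]
    have b1 := hH w
    have b2 := hH (-w)
    rw [neg_div x w, norm_neg] at b2
    linarith
  have ki : Integrable (fun y : ℝ => (1 + ‖y‖ ^ 2) ^ (-(5/4 : ℝ) / 2)) :=
    integrable_rpow_neg_one_add_norm_sq (by norm_num)
  have ki2 := (ki.comp_div hx.ne').const_mul (20 * |α| ^ (-(1:ℝ)/4) * x ^ (-(5:ℝ)/4))
  have Fc : Continuous (FourierTransform.fourier f) := by
    exact VectorFourier.fourierIntegral_continuous Real.continuous_fourierChar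
      continuous_inner fi
  have Fi : Integrable (FourierTransform.fourier f) :=
    Integrable.mono' ki2 Fc.aestronglyMeasurable (Filter.Eventually.of_forall hF)
  have hinv := fc.fourier_fourierInv_eq fi Fi
  have hneg : FourierTransformInv.fourierInv f = fun y => FourierTransform.fourier f (-y) := by
    funext y; exact Real.fourierInv_eq_fourier_neg f y
  refine ⟨FourierTransformInv.fourierInv f, ?_, ?_, ?_⟩
  · rw [hneg]; exact Fi.comp_neg
  · intro k
    have := congrFun hinv k
    rw [Real.fourier_real_eq_integral_exp_smul] at this
    change _ = f k
    rw [← this, fourierT]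
    refine integral_congr_ae (Filter.Eventually.of_forall fun y => ?_)
    simp only [smul_eq_mul]
    congr 2; push_cast; ring
  · rw [hneg, integral_neg_eq_self (fun y => ‖FourierTransform.fourier f y‖)]
    refine (integral_mono Fi.norm ki2 hF).trans ?_
    rw [integral_const_mul, Measure.integral_comp_div
      (fun y : ℝ => (1 + ‖y‖ ^ 2) ^ (-(5/4 : ℝ) / 2)) x, smul_eq_mul, abs_of_pos hx,
      Real.mul_rpow hb.le hx.le]
    have : x ^ (-(1:ℝ)/4) = x ^ (-(5:ℝ)/4) * x := by
      rw [← Real.rpow_add_one hx.ne']; norm_num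
    rw [this]
    apply le_of_eq; ring

/-- There is a universal `C > 0` such that for every `α ≠ 0` and `x > 0`
there exist integrable `g, g̃ : ℝ → ℂ` whose Fourier transforms satisfy, for all `k ≠ 0`,
`𝓕g(k) = ik e^{−|k|x}/(ik + α sgn k)` and `𝓕g̃(k) = |k| e^{−|k|x}/(ik + α sgn k)`, with
`∫|g| ≤ C (|α|x)^{−1/4}` and `∫|g̃| ≤ C (|α|x)^{−1/4}`. -/
theorem stmt18 :
    ∃ C : ℝ, 0 < C ∧ ∀ α x : ℝ, α ≠ 0 → 0 < x →
      ∃ g g' : ℝ → ℂ,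
        Integrable g (volume : Measure ℝ) ∧ Integrable g' (volume : Measure ℝ) ∧
        (∀ k : ℝ, k ≠ 0 → fourierT g k =
          Complex.I * (k : ℂ) * ((Real.exp (-|k| * x) : ℝ) : ℂ) /
            (Complex.I * (k : ℂ) + ((α * Real.sign k : ℝ) : ℂ))) ∧
        (∀ k : ℝ, k ≠ 0 → fourierT g' k =
          ((|k| : ℝ) : ℂ) * ((Real.exp (-|k| * x) : ℝ) : ℂ) /
            (Complex.I * (k : ℂ) + ((α * Real.sign k : ℝ) : ℂ))) ∧
        (∫ y : ℝ, ‖g y‖) ≤ C * (|α| * x) ^ (-(1 : ℝ) / 4) ∧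
        (∫ y : ℝ, ‖g' y‖) ≤ C * (|α| * x) ^ (-(1 : ℝ) / 4) := by
  have ki : Integrable (fun y : ℝ => (1 + ‖y‖ ^ 2) ^ (-(5/4 : ℝ) / 2)) :=
    integrable_rpow_neg_one_add_norm_sq (by norm_num)
  have hK : 0 ≤ ∫ y : ℝ, (1 + ‖y‖ ^ 2) ^ (-(5/4 : ℝ) / 2) :=
    integral_nonneg fun y => by positivity
  set K := ∫ y : ℝ, (1 + ‖y‖ ^ 2) ^ (-(5/4 : ℝ) / 2) with hKd
  refine ⟨20 * K + 1, by positivity, fun α x hα hx => ?_⟩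
  have hax : 0 < |α| * x := mul_pos (abs_pos.2 hα) hx
  have hmono : 20 * K * (|α| * x) ^ (-(1 : ℝ) / 4) ≤
      (20 * K + 1) * (|α| * x) ^ (-(1 : ℝ) / 4) := by
    gcongr; linarith
  obtain ⟨g, g1, g2, g3⟩ := aux_main α x hα hx (fun k => ((|k| : ℝ) : ℂ)) 1 (by simp)
    (by fun_prop) (fun t ht => by simp [abs_of_pos ht]) (fun t ht => by simp [abs_of_pos ht])
  obtain ⟨h, h1, h2, h3⟩ := aux_main α x hα hx (fun k => (k : ℂ)) (-1) (by simp)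
    (by fun_prop) (fun t ht => by simp) (fun t ht => by simp)
  have hn := aux_ne α hα
  have key : ∀ k : ℝ, k ≠ 0 → (Complex.I * (k : ℂ) + ((α * Real.sign k : ℝ) : ℂ)) =
      Complex.I * (Real.sign k : ℂ) * (|k| - Complex.I * α) := by
    intro k hk
    rcases lt_or_gt_of_ne hk with h | h
    · rw [Real.sign_of_neg h, abs_of_neg h]; push_cast; ring_nf; simp; ring
    · rw [Real.sign_of_pos h, abs_of_pos h]; push_cast; ring_nf; simp
  have hs : ∀ k : ℝ, k ≠ 0 → (Real.sign k : ℂ) * k = |k| ∧ (Real.sign k : ℂ) * |k| = k ∧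
      (Real.sign k : ℂ) * (Real.sign k : ℂ) = 1 := by
    intro k hk
    rcases lt_or_gt_of_ne hk with h | h
    · rw [Real.sign_of_neg h, abs_of_neg h]; simp
    · rw [Real.sign_of_pos h, abs_of_pos h]; simp
  refine ⟨g, fun y => -Complex.I * h y, g1, h1.const_mul _, ?_, ?_, g3.trans hmono, ?_⟩
  · intro k hk
    obtain ⟨s1, s2, s3⟩ := hs k hk
    have s0 : (Real.sign k : ℂ) ≠ 0 := left_ne_zero_of_mul_eq_one s3
    have hnk := hn |k|
    rw [g2 k, key k hk]
    have : (k : ℂ) = (Real.sign k : ℂ) * |k| := s2.symm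
    rw [show Complex.I * (k : ℂ) = Complex.I * ((Real.sign k : ℂ) * |k|) by rw [s2]]
    push_cast
    rw [neg_mul]
    field_simp
  · intro k hk
    obtain ⟨s1, s2, s3⟩ := hs k hk
    have s0 : (Real.sign k : ℂ) ≠ 0 := left_ne_zero_of_mul_eq_one s3
    have hnk := hn |k|
    have e : fourierT (fun y => -Complex.I * h y) k = -Complex.I * fourierT h k := by
      unfold fourierT
      rw [← integral_const_mul]
      congr 1; funext y; ring
    rw [e, h2 k, key k hk, ← s1]
    rw [← s1] at hnk
    push_cast
    rw [neg_mul, neg_mul, s1, ← s1]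
    have hI : (-Complex.I) = Complex.I⁻¹ := by simp
    rw [← neg_mul, hI]
    field_simp
  · simp only [norm_mul, norm_neg, Complex.norm_I, one_mul]
    exact h3.trans hmono
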